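/- Let U ⊂ ℝⁿ be a bounded open domain with C¹ boundary, and let q⃗ be a vector field in divBV(U), i.e. each coordinate q_i and the divergence div q⃗ are finite Radon measures over U. Then the quantity ⟨q⃗, ∇Y⟩_U + ⟨div q⃗, Y⟩_U, for Y ∈ C¹(Ū), depends only on the restriction Y|_{∂U}: if Y ∈ C¹(Ū) vanishes on ∂U then ⟨q⃗, ∇Y⟩_U + ⟨div q⃗, Y⟩_U = 0. Consequently the normal trace operator γ_ν : divBV(U) → (C¹(∂U))' is well-defined by the duality formula ⟨γ_ν q⃗, Y|_{∂U}⟩_{∂U} = ⟨q⃗, ∇Y⟩_U + ⟨div q⃗, Y⟩_U for all Y ∈ C¹(Ū). -/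

import Mathlib

open MeasureTheory Metric Set Filter Topology
open scoped Pointwise ENNReal NNReal

noncomputable section

abbrev Euc (n : ℕ) := EuclideanSpace ℝ (Fin n)

/-- Integral of a real function against a signed measure. -/
def sInt {α : Type*} [MeasurableSpace α] (μ : MeasureTheory.SignedMeasure α) (f : α → ℝ) : ℝ :=
  ∫ x, f x ∂μ.toJordanDecomposition.posPart - ∫ x, f x ∂μ.toJordanDecomposition.negPart

/-- A signed measure is concentrated on the set `S`. -/
def SuppOn {α : Type*} [MeasurableSpace α] (μ : MeasureTheory.SignedMeasure α) (S : Set α) : Prop :=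
  ∀ t : Set α, MeasurableSet t → t ∩ S = ∅ → μ t = 0

/-- Total variation mass of a finite family of signed measures, seen as a vector measure,
via duality against continuous fields of pointwise Euclidean norm at most one. -/
def vmass {α : Type*} [MeasurableSpace α] [TopologicalSpace α] {ι : Type*} [Fintype ι]
    (g : ι → MeasureTheory.SignedMeasure α) : ℝ :=
  sSup { r | ∃ Y : ι → α → ℝ, (∀ i, Continuous (Y i)) ∧ (∀ x, ∑ i, (Y i x) ^ 2 ≤ 1) ∧
      r = ∑ i, sInt (g i) (Y i) }

/-- `j`-th partial derivative. -/
def pd {n : ℕ} (j : Fin n) (ψ : Euc n → ℝ) (x : Euc n) : ℝ :=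
  fderiv ℝ ψ x (EuclideanSpace.single j 1)

/-- Smooth test function compactly supported in `U`. -/
def IsTestFun {n : ℕ} (U : Set (Euc n)) (ψ : Euc n → ℝ) : Prop :=
  ContDiff ℝ (⊤ : ℕ∞) ψ ∧ HasCompactSupport ψ ∧ tsupport ψ ⊆ U

/-- A `C¹` function with compact support (representing an element of `C¹(Ū)`). -/
def IsC1 {n : ℕ} (Y : Euc n → ℝ) : Prop := ContDiff ℝ 1 Y ∧ HasCompactSupport Y

/-- A symmetric Div-BV tensor on `U`: the entries and the row-wise distributional
divergence are finite (signed) Radon measures carried by `U`. -/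
structure DivBV (n : ℕ) (U : Set (Euc n)) where
  A : Fin n → Fin n → MeasureTheory.SignedMeasure (Euc n)
  divA : Fin n → MeasureTheory.SignedMeasure (Euc n)
  symm : ∀ i j, A i j = A j i
  suppA : ∀ i j, SuppOn (A i j) U
  suppDiv : ∀ i, SuppOn (divA i) U
  weak : ∀ i, ∀ ψ : Euc n → ℝ, IsTestFun U ψ →
    ∑ j, sInt (A i j) (pd j ψ) = - sInt (divA i) ψ

/-- Positive semi-definiteness of a matrix of measures. -/
def DivBV.PSD {n : ℕ} {U : Set (Euc n)} (T : DivBV n U) : Prop :=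
  ∀ ξ : Fin n → ℝ, ∀ s : Set (Euc n), MeasurableSet s →
    0 ≤ ∑ i, ∑ j, ξ i * ξ j * (T.A i j) s

/-- Density (Radon–Nikodym derivative w.r.t. Lebesgue) of a signed measure. -/
def sdens {n : ℕ} (μ : MeasureTheory.SignedMeasure (Euc n)) (x : Euc n) : ℝ :=
  (μ.toJordanDecomposition.posPart.rnDeriv volume x).toReal -
  (μ.toJordanDecomposition.negPart.rnDeriv volume x).toReal

/-- Pointwise determinant of the absolutely continuous part of a Div-BV tensor. -/
def DivBV.detDens {n : ℕ} {U : Set (Euc n)} (T : DivBV n U) (x : Euc n) : ℝ :=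
  Matrix.det (Matrix.of fun i j => sdens (T.A i j) x)

/-- Total mass `‖A‖_{M(U)}` of the tensor. -/
def DivBV.massA {n : ℕ} {U : Set (Euc n)} (T : DivBV n U) : ℝ :=
  vmass (fun p : Fin n × Fin n => T.A p.1 p.2)

/-- Total mass `‖Div A‖_{M(U)}` of the divergence. -/
def DivBV.massDiv {n : ℕ} {U : Set (Euc n)} (T : DivBV n U) : ℝ :=
  vmass T.divA

/-- The pairing `⟨A, ∇Y⟩_U + ⟨Div A, Y⟩_U` defining the normal trace `γ_ν A`. -/
def DivBV.tracePair {n : ℕ} {U : Set (Euc n)} (T : DivBV n U) (Y : Fin n → Euc n → ℝ) : ℝ :=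
  (∑ i, ∑ j, sInt (T.A i j) (pd j (Y i))) + ∑ i, sInt (T.divA i) (Y i)

/-- The normal trace `γ_ν A` is represented by the vector-valued measure `g` on `∂U`. -/
def DivBV.TraceMeas {n : ℕ} {U : Set (Euc n)} (T : DivBV n U)
    (g : Fin n → MeasureTheory.SignedMeasure (Euc n)) : Prop :=
  (∀ i, SuppOn (g i) (frontier U)) ∧
  ∀ Y : Fin n → Euc n → ℝ, (∀ i, IsC1 (Y i)) →
    T.tracePair Y = ∑ i, sInt (g i) (Y i)

/-- The tangential part `γ_ν^τ A` of the normal trace is represented by the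
vector-valued measure `g` on `∂U` (with outer unit normal field `ν`): `g` is carried by `∂U`,
is tangential, and represents the trace pairing against all `C¹` fields tangential along `∂U`. -/
def DivBV.TangTraceMeas {n : ℕ} {U : Set (Euc n)} (T : DivBV n U) (ν : Euc n → Euc n)
    (g : Fin n → MeasureTheory.SignedMeasure (Euc n)) : Prop :=
  (∀ i, SuppOn (g i) (frontier U)) ∧
  (∀ φ : Euc n → ℝ, Continuous φ → ∑ i, sInt (g i) (fun x => φ x * ν x i) = 0) ∧
  ∀ Y : Fin n → Euc n → ℝ, (∀ i, IsC1 (Y i)) →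
    (∀ x ∈ frontier U, ∑ i, Y i x * ν x i = 0) →
    T.tracePair Y = ∑ i, sInt (g i) (Y i)

/-- A domain whose boundary is a `C^k` hypersurface, presented by a defining function. -/
structure CkDomain (n k : ℕ) (U : Set (Euc n)) where
  f : Euc n → ℝ
  O : Set (Euc n)
  opO : IsOpen O
  front : frontier U ⊆ O
  smooth : ContDiffOn ℝ k f O
  grad_ne : ∀ x ∈ frontier U, gradient f x ≠ 0
  neg : ∀ x ∈ O ∩ U, f x < 0
  pos : ∀ x ∈ O \ closure U, 0 < f x
  zero : ∀ x ∈ frontier U, f x = 0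

/-- The outer unit normal field (normalized gradient of the defining function). -/
def CkDomain.nu {n k : ℕ} {U : Set (Euc n)} (B : CkDomain n k U) (x : Euc n) : Euc n :=
  ‖gradient B.f x‖⁻¹ • gradient B.f x

/-- `L(Σ)`: the largest `L` such that every point at distance `< L` of `Σ` has a unique
nearest point on `Σ`. -/
def uniqRadius {n : ℕ} (S : Set (Euc n)) : ℝ :=
  sSup { L : ℝ | 0 ≤ L ∧ ∀ x : Euc n, infDist x S < L →
    ∃! a, a ∈ S ∧ dist x a = infDist x S }

open Classical in
/-- Nearest-point projection on `S` (junk value if no nearest point exists). -/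
def nearestPt {n : ℕ} (S : Set (Euc n)) (x : Euc n) : Euc n :=
  if h : ∃ a, a ∈ S ∧ dist x a = infDist x S then h.choose else x

/-- The geometric extension `ν ∘ π_Σ` of the unit normal to a tubular neighbourhood. -/
def CkDomain.nuGeo {n k : ℕ} {U : Set (Euc n)} (B : CkDomain n k U) (x : Euc n) : Euc n :=
  B.nu (nearestPt (frontier U) x)

/-- `K(Σ) = max (1/L(Σ), L(Σ) ‖D²ν‖_∞)`. -/
def CkDomain.Kconst {n k : ℕ} {U : Set (Euc n)} (B : CkDomain n k U) : ℝ :=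
  max (uniqRadius (frontier U))⁻¹
    (uniqRadius (frontier U) *
      sSup ((fun a => ‖fderiv ℝ (fderiv ℝ B.nuGeo) a‖) '' frontier U))

/-- The reflection `σ(x) = 2π_Σ(x) − x` across `Σ`. -/
def reflAcross {n : ℕ} (S : Set (Euc n)) (x : Euc n) : Euc n :=
  (2 : ℝ) • nearestPt S x - x


/-- Mollification by a normed bump function preserves Lipschitz constants. -/
theorem LipschitzWith.normed_convolution {E : Type*} [NormedAddCommGroup E] [NormedSpace ℝ E]
    [FiniteDimensional ℝ E] [MeasurableSpace E] [BorelSpace E] {μ : Measure E}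
    [μ.IsAddHaarMeasure] {K : ℝ≥0} {g : E → ℝ} (hg : LipschitzWith K g)
    (φ : ContDiffBump (0 : E)) :
    LipschitzWith K
      (convolution (φ.normed μ) g (ContinuousLinearMap.lsmul ℝ ℝ) μ : E → ℝ) := by
  refine LipschitzWith.of_dist_le_mul fun x y => ?_
  have hex := φ.hasCompactSupport_normed (μ := μ).convolutionExists_left
    (ContinuousLinearMap.lsmul ℝ ℝ) φ.continuous_normed
    (hg.continuous.locallyIntegrable (μ := μ))
  rw [dist_eq_norm, convolution_def, convolution_def, ← integral_sub (hex x) (hex y)]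
  calc ‖∫ t, (ContinuousLinearMap.lsmul ℝ ℝ (φ.normed μ t) (g (x - t)) -
          ContinuousLinearMap.lsmul ℝ ℝ (φ.normed μ t) (g (y - t))) ∂μ‖
      ≤ ∫ t, φ.normed μ t * (K * dist x y) ∂μ := by
        refine norm_integral_le_of_norm_le (φ.integrable_normed.mul_const _)
          (Eventually.of_forall fun t => ?_)
        rw [ContinuousLinearMap.lsmul_apply, ContinuousLinearMap.lsmul_apply, ← smul_sub,
          norm_smul, Real.norm_of_nonneg (φ.nonneg_normed t), ← dist_eq_norm]
        refine mul_le_mul_of_nonneg_left ?_ (φ.nonneg_normed t)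
        simpa using hg.dist_le_mul (x - t) (y - t)
    _ = K * dist x y := by
        rw [integral_mul_const, φ.integral_normed, one_mul]

/-- A Lipschitz function vanishing on the frontier of `U` is controlled in `U` by the distance to
the complement. -/
theorem LipschitzWith.abs_le_mul_infDist_compl {n : ℕ} {U : Set (Euc n)} (hU : U ≠ univ)
    {L : ℝ≥0} {Y : Euc n → ℝ} (hL : LipschitzWith L Y) (h0 : ∀ x ∈ frontier U, Y x = 0)
    {x : Euc n} (hx : x ∈ U) : |Y x| ≤ L * infDist x Uᶜ := by
  obtain ⟨y, hy, hxy⟩ := exists_mem_frontier_infDist_compl_eq_dist hx hU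
  simpa [h0 y hy, Real.dist_eq, hxy] using hL.dist_le_mul x y

/-- The truncation of `Y` between `±2L(d - 2ε)₊`, with `d` the distance to the complement
of `U`. It vanishes where `d ≤ 2ε`. -/
def boundaryTrunc {n : ℕ} (U : Set (Euc n)) (L : ℝ≥0) (Y : Euc n → ℝ) (ε : ℝ) (x : Euc n) : ℝ :=
  max (min (Y x) ((2 * L : ℝ≥0) * max (infDist x Uᶜ - 2 * ε) 0))
    (-((2 * L : ℝ≥0) * max (infDist x Uᶜ - 2 * ε) 0))

section BoundaryTrunc

variable {n : ℕ} {U : Set (Euc n)} {L : ℝ≥0} {Y : Euc n → ℝ} {ε : ℝ}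

theorem lipschitzWith_boundaryTrunc (hL : LipschitzWith L Y) :
    LipschitzWith (2 * L) (boundaryTrunc U L Y ε) := by
  have hd : LipschitzWith (2 * L)
      fun x => ((2 * L : ℝ≥0) : ℝ) * max (infDist x Uᶜ - 2 * ε) 0 := by
    have h1 : LipschitzWith 1 fun x => max (infDist x Uᶜ - 2 * ε) 0 := by
      refine LipschitzWith.max_const (LipschitzWith.of_dist_le_mul fun x y => ?_) 0
      simpa using (lipschitz_infDist_pt Uᶜ).dist_le_mul x y
    refine LipschitzWith.of_dist_le_mul fun x y => ?_
    rw [Real.dist_eq, ← mul_sub, abs_mul, abs_of_nonneg (NNReal.coe_nonneg _), ← Real.dist_eq]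
    exact mul_le_mul_of_nonneg_left (by simpa using h1.dist_le_mul x y) (NNReal.coe_nonneg _)
  refine ((hL.min hd).max hd.neg).weaken ?_
  have : L ≤ 2 * L := by
    rw [two_mul]
    exact le_add_of_nonneg_left zero_le
  simp [this]

theorem abs_boundaryTrunc_le (x : Euc n) : |boundaryTrunc U L Y ε x| ≤ |Y x| := by
  have h : (0 : ℝ) ≤ (2 * L : ℝ≥0) * max (infDist x Uᶜ - 2 * ε) 0 := by positivity
  unfold boundaryTrunc
  refine abs_le.2 ⟨le_max_of_le_left (le_min (neg_abs_le _) ?_), max_le ?_ ?_⟩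
  · linarith [abs_nonneg (Y x)]
  · exact (min_le_left _ _).trans (le_abs_self _)
  · linarith [abs_nonneg (Y x)]

theorem boundaryTrunc_eq_zero {x : Euc n} (hx : infDist x Uᶜ ≤ 2 * ε) :
    boundaryTrunc U L Y ε x = 0 := by
  simp [boundaryTrunc, max_eq_right (sub_nonpos.2 hx)]

theorem boundaryTrunc_eq_self (hU : U ≠ univ) (hL : LipschitzWith L Y)
    (h0 : ∀ x ∈ frontier U, Y x = 0) (hε : 0 ≤ ε) {x : Euc n} (hxU : x ∈ U)
    (hx : 4 * ε ≤ infDist x Uᶜ) : boundaryTrunc U L Y ε x = Y x := by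
  have h1 := abs_le.1 (hL.abs_le_mul_infDist_compl hU h0 hxU)
  have h2 : (L : ℝ) * infDist x Uᶜ ≤ (2 * L : ℝ≥0) * max (infDist x Uᶜ - 2 * ε) 0 := by
    rw [max_eq_left (by linarith)]
    push_cast
    nlinarith [L.coe_nonneg]
  rw [boundaryTrunc, min_eq_left (by linarith), max_eq_left (by linarith)]

end BoundaryTrunc

/-- The bump function at the origin with radii `ε / 2` and `ε`. -/
def radiusBump (n : ℕ) {ε : ℝ} (hε : 0 < ε) : ContDiffBump (0 : Euc n) :=
  ⟨ε / 2, ε, half_pos hε, half_lt_self hε⟩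

/-- Test functions on `U` approximating a function which vanishes on the frontier. -/
def testApprox {n : ℕ} (U : Set (Euc n)) (L : ℝ≥0) (Y : Euc n → ℝ) {ε : ℝ} (hε : 0 < ε) :
    Euc n → ℝ :=
  convolution ((radiusBump n hε).normed volume) (boundaryTrunc U L Y ε)
    (ContinuousLinearMap.lsmul ℝ ℝ) volume

section TestApprox

variable {n : ℕ} {U : Set (Euc n)} {L : ℝ≥0} {Y : Euc n → ℝ} {ε : ℝ}

theorem isTestFun_testApprox (hb : Bornology.IsBounded U) (hU : U ≠ univ)
    (hL : LipschitzWith L Y) (hε : 0 < ε) : IsTestFun U (testApprox U L Y hε) := by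
  have hne : (Uᶜ).Nonempty := nonempty_compl.2 hU
  have hsub : tsupport (testApprox U L Y hε) ⊆ {x | ε ≤ infDist x Uᶜ} := by
    refine closure_minimal (fun x hx => ?_)
      (isClosed_le continuous_const (continuous_infDist_pt _))
    by_contra hlt
    simp only [mem_ofPred_eq, not_le] at hlt
    refine hx ?_
    have hz : boundaryTrunc U L Y ε x = 0 := boundaryTrunc_eq_zero (by linarith)
    rw [testApprox, ContDiffBump.normed_convolution_eq_right _, hz]
    intro y hy
    rw [hz]
    refine boundaryTrunc_eq_zero ?_
    have h1 : infDist y Uᶜ ≤ infDist x Uᶜ + dist y x := infDist_le_infDist_add_dist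
    have h2 : dist y x < ε := hy
    linarith
  have hsubU : {x | ε ≤ infDist x Uᶜ} ⊆ U := by
    intro x hx
    by_contra hxU
    have h1 : infDist x Uᶜ = 0 := infDist_zero_of_mem hxU
    have h2 : ε ≤ infDist x Uᶜ := hx
    linarith
  refine ⟨?_, ?_, hsub.trans hsubU⟩
  · exact (radiusBump n hε).hasCompactSupport_normed.contDiff_convolution_left _
      (radiusBump n hε).contDiff_normed
      (lipschitzWith_boundaryTrunc hL).continuous.locallyIntegrable
  · exact isCompact_of_isClosed_isBounded (isClosed_tsupport _)
      (hb.subset (hsub.trans hsubU))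

theorem lipschitzWith_testApprox (hL : LipschitzWith L Y) (hε : 0 < ε) :
    LipschitzWith (2 * L) (testApprox U L Y hε) :=
  (lipschitzWith_boundaryTrunc hL).normed_convolution _

theorem abs_testApprox_sub_boundaryTrunc_le (hL : LipschitzWith L Y) (hε : 0 < ε) (x : Euc n) :
    |testApprox U L Y hε x - boundaryTrunc U L Y ε x| ≤ 2 * L * ε := by
  have hW := lipschitzWith_boundaryTrunc (U := U) (ε := ε) hL
  rw [← Real.dist_eq]
  refine ContDiffBump.dist_normed_convolution_le hW.continuous.aestronglyMeasurable
    fun y hy => (hW.dist_le_mul y x).trans ?_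
  push_cast
  exact mul_le_mul_of_nonneg_left (le_of_lt hy) (by positivity)

theorem testApprox_eventuallyEq (hU : U ≠ univ) (hL : LipschitzWith L Y)
    (h0 : ∀ x ∈ frontier U, Y x = 0) (hε : 0 < ε) {x : Euc n}
    (hx : 5 * ε < infDist x Uᶜ) :
    testApprox U L Y hε =ᶠ[𝓝 x] convolution ((radiusBump n hε).normed volume) Y
      (ContinuousLinearMap.lsmul ℝ ℝ) volume := by
  have hev : ∀ᶠ y in 𝓝 x, 5 * ε < infDist y Uᶜ :=
    (continuous_infDist_pt Uᶜ).continuousAt.eventually_const_lt hx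
  filter_upwards [hev] with y hy
  rw [testApprox, convolution_def, convolution_def]
  refine integral_congr_ae (Eventually.of_forall fun t => ?_)
  by_cases ht : t ∈ ball (0 : Euc n) ε
  · have h1 : infDist y Uᶜ ≤ infDist (y - t) Uᶜ + dist y (y - t) := infDist_le_infDist_add_dist
    have h2 : dist y (y - t) < ε := by simpa using ht
    have h3 : y - t ∈ U := by
      by_contra hyt
      have : infDist (y - t) Uᶜ = 0 := infDist_zero_of_mem hyt
      linarith
    simp only
    rw [boundaryTrunc_eq_self hU hL h0 hε.le h3 (by linarith)]
  · have : (radiusBump n hε).normed volume t = 0 := by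
      rw [← Function.notMem_support, ContDiffBump.support_normed_eq]
      exact ht
    simp [this]

theorem fderiv_testApprox (hU : U ≠ univ) (hY : IsC1 Y)
    (hL : LipschitzWith L Y) (h0 : ∀ x ∈ frontier U, Y x = 0) (hε : 0 < ε) {x : Euc n}
    (hx : 5 * ε < infDist x Uᶜ) :
    fderiv ℝ (testApprox U L Y hε) x =
      convolution ((radiusBump n hε).normed volume) (fderiv ℝ Y)
        (ContinuousLinearMap.lsmul ℝ ℝ) volume x := by
  rw [(testApprox_eventuallyEq hU hL h0 hε hx).fderiv_eq,
    (hY.2.hasFDerivAt_convolution_right _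
      (radiusBump n hε).continuous_normed.locallyIntegrable hY.1 x).fderiv,
    convolution_def, convolution_def]
  refine integral_congr_ae (Eventually.of_forall fun t => ?_)
  ext v
  simp [ContinuousLinearMap.precompR_apply]

end TestApprox

/-- A `C¹` function vanishing on the frontier of `U` is a limit in `U`, with its derivative,
of test functions which are bounded and have bounded derivatives. -/
theorem IsC1.exists_isTestFun_tendsto {n : ℕ} {U : Set (Euc n)} (hUo : IsOpen U)
    (hb : Bornology.IsBounded U) (hU : U ≠ univ) {Y : Euc n → ℝ} (hY : IsC1 Y)
    (h0 : ∀ x ∈ frontier U, Y x = 0) :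
    ∃ (Z : ℕ → Euc n → ℝ) (C : ℝ), (∀ k, IsTestFun U (Z k)) ∧ (∀ k x, |Z k x| ≤ C) ∧
      (∀ k x, ‖fderiv ℝ (Z k) x‖ ≤ C) ∧
      (∀ x ∈ U, Tendsto (fun k => Z k x) atTop (𝓝 (Y x))) ∧
      (∀ x ∈ U, Tendsto (fun k => fderiv ℝ (Z k) x) atTop (𝓝 (fderiv ℝ Y x))) := by
  obtain ⟨L, hL⟩ := hY.1.lipschitzWith_of_hasCompactSupport hY.2 one_ne_zero
  obtain ⟨M, hM⟩ := hY.2.exists_bound_of_continuous hY.1.continuous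
  have hpos : ∀ k : ℕ, (0 : ℝ) < 1 / (k + 1) := fun k => Nat.one_div_pos_of_nat
  have hlim : Tendsto (fun k : ℕ => (1 : ℝ) / (k + 1)) atTop (𝓝 0) :=
    tendsto_one_div_add_atTop_nhds_zero_nat
  have hdist : ∀ x ∈ U, ∀ᶠ k : ℕ in atTop, 5 * ((1 : ℝ) / (k + 1)) < infDist x Uᶜ := by
    intro x hx
    have hd : 0 < infDist x Uᶜ :=
      (hUo.isClosed_compl.notMem_iff_infDist_pos (nonempty_compl.2 hU)).1 (by simpa using hx)
    exact (hlim.const_mul 5).eventually_lt_const (by simpa using hd)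
  have hsub := fun k x => abs_testApprox_sub_boundaryTrunc_le (U := U) hL (hpos k) x
  refine ⟨fun k => testApprox U L Y (hpos k), max (M + 2 * L) (2 * L),
    fun k => isTestFun_testApprox hb hU hL (hpos k), fun k x => le_max_of_le_left ?_,
    fun k x => le_max_of_le_right ?_, fun x hx => ?_, fun x hx => ?_⟩
  · have h1 : (1 : ℝ) / (k + 1) ≤ 1 := by
      rw [div_le_one (by positivity)]
      simp
    have h2 : 2 * L * ((1 : ℝ) / (k + 1)) ≤ 2 * L :=
      mul_le_of_le_one_right (by positivity) h1
    have h3 : |boundaryTrunc U L Y (1 / ((k : ℝ) + 1)) x| ≤ M :=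
      (abs_boundaryTrunc_le x).trans (hM x)
    have h4 := abs_sub_abs_le_abs_sub (testApprox U L Y (hpos k) x)
      (boundaryTrunc U L Y (1 / ((k : ℝ) + 1)) x)
    linarith [hsub k x]
  · simpa using norm_fderiv_le_of_lipschitz ℝ (lipschitzWith_testApprox (U := U) hL (hpos k))
  · rw [tendsto_iff_dist_tendsto_zero]
    refine squeeze_zero' (Eventually.of_forall fun _ => dist_nonneg) ?_
      (by simpa only [mul_zero] using hlim.const_mul (2 * L : ℝ))
    filter_upwards [hdist x hx] with k hk
    have := hsub k x
    rwa [boundaryTrunc_eq_self hU hL h0 (hpos k).le hx (by linarith [hpos k]),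
      ← Real.dist_eq] at this
  · refine Tendsto.congr' ?_ (ContDiffBump.convolution_tendsto_right_of_continuous
      (μ := volume) (φ := fun k => radiusBump n (hpos k)) hlim
      (hY.1.continuous_fderiv one_ne_zero) x)
    filter_upwards [hdist x hx] with k hk
    exact (fderiv_testApprox hU hY hL h0 (hpos k) hk).symm

section SignedIntegral

variable {α : Type*} [MeasurableSpace α]

theorem SuppOn.posPart_compl {μ : SignedMeasure α} {S : Set α} (h : SuppOn μ S)
    (hS : MeasurableSet S) : μ.toJordanDecomposition.posPart Sᶜ = 0 := by
  obtain ⟨i, hi, hi₂, hi₃, hp, -⟩ := μ.toJordanDecomposition_spec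
  rw [hp, SignedMeasure.toMeasureOfZeroLE_apply _ hi₂ hi hS.compl]
  have := h (i ∩ Sᶜ) (hi.inter hS.compl) (by rw [inter_assoc, compl_inter_self, inter_empty])
  simp [this]

theorem SuppOn.negPart_compl {μ : SignedMeasure α} {S : Set α} (h : SuppOn μ S)
    (hS : MeasurableSet S) : μ.toJordanDecomposition.negPart Sᶜ = 0 := by
  obtain ⟨i, hi, hi₂, hi₃, -, hp⟩ := μ.toJordanDecomposition_spec
  rw [hp, SignedMeasure.toMeasureOfLEZero_apply _ hi₃ hi.compl hS.compl]
  have := h (iᶜ ∩ Sᶜ) (hi.compl.inter hS.compl)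
    (by rw [inter_assoc, compl_inter_self, inter_empty])
  simp [this]

theorem SuppOn.tendsto_sInt {μ : SignedMeasure α} {S : Set α} (h : SuppOn μ S)
    (hS : MeasurableSet S) {F : ℕ → α → ℝ} {G : α → ℝ} {C : ℝ} (hF : ∀ k, Measurable (F k))
    (hC : ∀ k x, |F k x| ≤ C) (hlim : ∀ x ∈ S, Tendsto (fun k => F k x) atTop (𝓝 (G x))) :
    Tendsto (fun k => sInt μ (F k)) atTop (𝓝 (sInt μ G)) := by
  have key : ∀ ν : Measure α, IsFiniteMeasure ν → ν Sᶜ = 0 →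
      Tendsto (fun k => ∫ x, F k x ∂ν) atTop (𝓝 (∫ x, G x ∂ν)) := by
    intro ν _ hν
    refine tendsto_integral_of_dominated_convergence (fun _ => C)
      (fun k => (hF k).aestronglyMeasurable) (integrable_const C)
      (fun k => Eventually.of_forall (hC k)) ?_
    filter_upwards [mem_ae_iff.2 hν] with x hx using hlim x hx
  exact (key _ inferInstance (h.posPart_compl hS)).sub (key _ inferInstance (h.negPart_compl hS))

theorem sInt_sub [TopologicalSpace α] [OpensMeasurableSpace α] (μ : SignedMeasure α)
    {f g : α → ℝ} (hf : Continuous f) (hfc : HasCompactSupport f) (hg : Continuous g)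
    (hgc : HasCompactSupport g) : sInt μ (fun x => f x - g x) = sInt μ f - sInt μ g := by
  unfold sInt
  rw [integral_sub (hf.integrable_of_hasCompactSupport hfc)
      (hg.integrable_of_hasCompactSupport hgc),
    integral_sub (hf.integrable_of_hasCompactSupport hfc)
      (hg.integrable_of_hasCompactSupport hgc)]
  ring

end SignedIntegral

section PartialDerivative

variable {n : ℕ}

theorem continuous_pd {Y : Euc n → ℝ} (hY : ContDiff ℝ 1 Y) (i : Fin n) :
    Continuous (pd i Y) :=
  (hY.continuous_fderiv one_ne_zero).clm_apply continuous_const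

theorem abs_pd_le (Y : Euc n → ℝ) (i : Fin n) (x : Euc n) : |pd i Y x| ≤ ‖fderiv ℝ Y x‖ := by
  simpa [pd] using (fderiv ℝ Y x).le_opNorm (EuclideanSpace.single i 1)

theorem hasCompactSupport_pd {Y : Euc n → ℝ} (hY : HasCompactSupport Y) (i : Fin n) :
    HasCompactSupport (pd i Y) :=
  hY.fderiv_apply ℝ _

end PartialDerivative

/-- If a vector field of signed measures has divergence `dq` in `U`, its trace pairing vanishes
on the `C¹` functions which are zero on the frontier. -/
theorem sum_sInt_pd_add_sInt_eq_zero {n : ℕ} {U : Set (Euc n)} (hU : IsOpen U)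
    (hb : Bornology.IsBounded U) {q : Fin n → SignedMeasure (Euc n)} {dq : SignedMeasure (Euc n)}
    (hsupp : ∀ i, SuppOn (q i) U) (hds : SuppOn dq U)
    (hweak : ∀ ψ : Euc n → ℝ, IsTestFun U ψ → ∑ i, sInt (q i) (pd i ψ) = - sInt dq ψ)
    {Y : Euc n → ℝ} (hY : IsC1 Y) (h0 : ∀ x ∈ frontier U, Y x = 0) :
    (∑ i, sInt (q i) (pd i Y)) + sInt dq Y = 0 := by
  by_cases huniv : U = univ
  · subst huniv
    have : Subsingleton (Euc n) := by
      by_contra hns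
      have := not_subsingleton_iff_nontrivial.1 hns
      exact NormedSpace.unbounded_univ ℝ (Euc n) hb
    have hYs : ContDiff ℝ (⊤ : ℕ∞) Y := by
      rw [show Y = fun _ => Y 0 from funext fun x => congrArg Y (Subsingleton.elim x 0)]
      exact contDiff_const
    rw [hweak Y ⟨hYs, hY.2, subset_univ _⟩, neg_add_cancel]
  obtain ⟨Z, C, hZ, hZC, hZC', hZlim, hZlim'⟩ := hY.exists_isTestFun_tendsto hU hb huniv h0
  have hZ1 : ∀ k, ContDiff ℝ 1 (Z k) := fun k => (hZ k).1.of_le (mod_cast le_top)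
  have hlim : Tendsto (fun k => (∑ i, sInt (q i) (pd i (Z k))) + sInt dq (Z k)) atTop
      (𝓝 ((∑ i, sInt (q i) (pd i Y)) + sInt dq Y)) := by
    refine (tendsto_finsetSum _ fun i _ => ?_).add ?_
    · exact (hsupp i).tendsto_sInt hU.measurableSet
        (fun k => (continuous_pd (hZ1 k) i).measurable)
        (fun k x => (abs_pd_le (Z k) i x).trans (hZC' k x))
        (fun x hx => ((ContinuousLinearMap.apply ℝ ℝ (EuclideanSpace.single i 1)).continuous.tendsto
          (fderiv ℝ Y x)).comp (hZlim' x hx))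
    · exact hds.tendsto_sInt hU.measurableSet (fun k => (hZ1 k).continuous.measurable) hZC hZlim
  refine tendsto_nhds_unique hlim (tendsto_const_nhds.congr fun k => ?_)
  rw [hweak _ (hZ k), neg_add_cancel]

/-- Appendix A: the normal trace of a div-BV vector field is
well-defined: the pairing `⟨q, ∇Y⟩_U + ⟨div q, Y⟩_U` vanishes whenever `Y ∈ C¹(Ū)` vanishes
on `∂U`, hence depends only on `Y|_{∂U}`. -/
theorem stmt13 (n : ℕ) (U : Set (Euc n)) (hU : IsOpen U)
    (hb : Bornology.IsBounded U) (hne : U.Nonempty) (B : CkDomain n 1 U)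
    (q : Fin n → MeasureTheory.SignedMeasure (Euc n)) (dq : MeasureTheory.SignedMeasure (Euc n))
    (hsupp : ∀ i, SuppOn (q i) U) (hds : SuppOn dq U)
    (hweak : ∀ ψ : Euc n → ℝ, IsTestFun U ψ →
      ∑ i, sInt (q i) (pd i ψ) = - sInt dq ψ) :
    (∀ Y : Euc n → ℝ, IsC1 Y → (∀ x ∈ frontier U, Y x = 0) →
      (∑ i, sInt (q i) (pd i Y)) + sInt dq Y = 0) ∧
    (∀ Y₁ Y₂ : Euc n → ℝ, IsC1 Y₁ → IsC1 Y₂ → (∀ x ∈ frontier U, Y₁ x = Y₂ x) →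
      (∑ i, sInt (q i) (pd i Y₁)) + sInt dq Y₁ =
        (∑ i, sInt (q i) (pd i Y₂)) + sInt dq Y₂) := by
  have hzero : ∀ Y : Euc n → ℝ, IsC1 Y → (∀ x ∈ frontier U, Y x = 0) →
      (∑ i, sInt (q i) (pd i Y)) + sInt dq Y = 0 := fun Y hY h0 =>
    sum_sInt_pd_add_sInt_eq_zero hU hb hsupp hds hweak hY h0
  refine ⟨hzero, fun Y₁ Y₂ h₁ h₂ heq => ?_⟩
  have h := hzero (fun x => Y₁ x - Y₂ x) ⟨h₁.1.sub h₂.1, h₁.2.sub h₂.2⟩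
    fun x hx => sub_eq_zero.2 (heq x hx)
  have hpd : ∀ i, pd i (fun x => Y₁ x - Y₂ x) = fun x => pd i Y₁ x - pd i Y₂ x := by
    intro i
    funext x
    simp only [pd]
    rw [fderiv_fun_sub (h₁.1.differentiable one_ne_zero x) (h₂.1.differentiable one_ne_zero x)]
    rfl
  have hsub : ∀ i, sInt (q i) (pd i fun x => Y₁ x - Y₂ x) =
      sInt (q i) (pd i Y₁) - sInt (q i) (pd i Y₂) := fun i => by
    rw [hpd i, sInt_sub _ (continuous_pd h₁.1 i) (hasCompactSupport_pd h₁.2 i)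
      (continuous_pd h₂.1 i) (hasCompactSupport_pd h₂.2 i)]
  rw [sInt_sub _ h₁.1.continuous h₁.2 h₂.1.continuous h₂.2] at h
  simp only [hsub, Finset.sum_sub_distrib] at h
  linarith

end
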